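/- Let (C,P) be an elementary existential doctrine. Every functional relation F ∈ P(Y×A) from Y to A is left adjoint to F^op = ⟨π₂,π₁⟩*F ∈ P(A×Y): one has δ_Y ≤ F^op∘F in P(Y×Y) and F∘F^op ≤ δ_A in P(A×A), where ∘ denotes relational composition. -/

import Mathlib

open CategoryTheory CategoryTheory.Limits

noncomputable section

universe w v u

/-- The data of a doctrine on a category `C` with finite products, together with chosen
left adjoints to reindexing: `P` assigns to every object an inf-semilattice with top,
`map f` is reindexing `f*` along `f`, and `ex f` is the chosen left adjoint `∃_f`. -/
structure DoctrineData (C : Type u) [Category.{v} C] [HasFiniteProducts C] where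
  P : C → Type w
  [instSemilatticeInf : ∀ A : C, SemilatticeInf (P A)]
  [instOrderTop : ∀ A : C, OrderTop (P A)]
  map : ∀ {A B : C}, (A ⟶ B) → P B → P A
  ex : ∀ {A B : C}, (A ⟶ B) → P A → P B

attribute [instance] DoctrineData.instSemilatticeInf DoctrineData.instOrderTop

variable {C : Type u} [Category.{v} C] [HasFiniteProducts C]

/-- The pairing `⟨π₁,π₂⟩ : (X×A)×B ⟶ X×A` of the first two projections of a triple product. -/
def p12 (X A B : C) : (X ⨯ A) ⨯ B ⟶ (X ⨯ A) :=
  prod.lift (prod.fst ≫ prod.fst) (prod.fst ≫ prod.snd)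

/-- The pairing `⟨π₁,π₃⟩ : (X×A)×B ⟶ X×B` of the first and third projections. -/
def p13 (X A B : C) : (X ⨯ A) ⨯ B ⟶ (X ⨯ B) :=
  prod.lift (prod.fst ≫ prod.fst) prod.snd

/-- The pairing `⟨π₂,π₃⟩ : (X×A)×B ⟶ A×B` of the second and third projections. -/
def p23 (X A B : C) : (X ⨯ A) ⨯ B ⟶ (A ⨯ B) :=
  prod.lift (prod.fst ≫ prod.snd) prod.snd

namespace DoctrineData

variable (D : DoctrineData.{w} C)

/-- `(C,P)` is an elementary existential doctrine: `P` is a contravariant functor into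
inf-semilattices with top, each `ex f` is left adjoint to `map f`, and the adjoints satisfy
the Beck–Chevalley condition and Frobenius reciprocity. -/
structure IsEED : Prop where
  map_id : ∀ {A : C} (φ : D.P A), D.map (𝟙 A) φ = φ
  map_comp : ∀ {A B E : C} (f : A ⟶ B) (g : B ⟶ E) (φ : D.P E),
    D.map (f ≫ g) φ = D.map f (D.map g φ)
  map_inf : ∀ {A B : C} (f : A ⟶ B) (φ ψ : D.P B),
    D.map f (φ ⊓ ψ) = D.map f φ ⊓ D.map f ψ
  map_top : ∀ {A B : C} (f : A ⟶ B), D.map f (⊤ : D.P B) = ⊤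
  adj : ∀ {A B : C} (f : A ⟶ B) (α : D.P A) (β : D.P B),
    D.ex f α ≤ β ↔ α ≤ D.map f β
  beck_chevalley : ∀ {X Y Z W : C} {f : X ⟶ Y} {g : X ⟶ Z} {h : Y ⟶ W} {k : Z ⟶ W},
    IsPullback f g h k → ∀ φ : D.P Z, D.ex f (D.map g φ) = D.map h (D.ex k φ)
  frobenius : ∀ {A B : C} (f : A ⟶ B) (α : D.P A) (β : D.P B),
    D.ex f (α ⊓ D.map f β) = D.ex f α ⊓ β

/-- The equality predicate `δ_A = ∃_{Δ_A} ⊤_A ∈ P(A×A)`. -/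
def delta (A : C) : D.P (A ⨯ A) := D.ex (diag A) ⊤

/-- `F ∈ P(Y×A)` is a functional relation from `Y` to `A`:
`⟨π₁,π₂⟩*F ∧ ⟨π₁,π₃⟩*F ≤ ⟨π₂,π₃⟩*δ_A` and `∃_{π₁} F = ⊤_Y`. -/
def IsFunctional {Y A : C} (F : D.P (Y ⨯ A)) : Prop :=
  (D.map (p12 Y A A) F ⊓ D.map (p13 Y A A) F ≤ D.map (p23 Y A A) (D.delta A)) ∧
    D.ex (prod.fst : Y ⨯ A ⟶ Y) F = ⊤

/-- The internal graph `Γf = (f×id_A)*δ_A ∈ P(Y×A)` of a morphism `f : Y ⟶ A`. -/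
def graph {Y A : C} (f : Y ⟶ A) : D.P (Y ⨯ A) :=
  D.map (prod.map f (𝟙 A)) (D.delta A)

/-- Relational composition of `F ∈ P(A×B)` and `G ∈ P(B×E)`:
`G ∘ F = ∃_{⟨π₁,π₃⟩}(⟨π₁,π₂⟩*F ∧ ⟨π₂,π₃⟩*G) ∈ P(A×E)` (written in diagrammatic order). -/
def relComp {A B E : C} (F : D.P (A ⨯ B)) (G : D.P (B ⨯ E)) : D.P (A ⨯ E) :=
  D.ex (p13 A B E) (D.map (p12 A B E) F ⊓ D.map (p23 A B E) G)

/-- The opposite relation `F^op = ⟨π₂,π₁⟩*F ∈ P(A×Y)` of `F ∈ P(Y×A)`. -/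
def opp {Y A : C} (F : D.P (Y ⨯ A)) : D.P (A ⨯ Y) :=
  D.map (prod.lift prod.snd prod.fst : (A ⨯ Y) ⟶ (Y ⨯ A)) F

/-- `f : A ⟶ B` is internally injective: `δ_A = (f×f)*δ_B`. -/
def InternallyInjective {A B : C} (f : A ⟶ B) : Prop :=
  D.delta A = D.map (prod.map f f) (D.delta B)

/-- `f : A ⟶ B` is internally surjective: `∃_f ⊤_A = ⊤_B`. -/
def InternallySurjective {A B : C} (f : A ⟶ B) : Prop :=
  D.ex f (⊤ : D.P A) = ⊤

/-- `f` is internally bijective if it is internally injective and internally surjective. -/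
def InternallyBijective {A B : C} (f : A ⟶ B) : Prop :=
  D.InternallyInjective f ∧ D.InternallySurjective f

/-- `A` is a complete object: every functional relation into `A` is the internal graph
of a unique morphism of `C`. -/
def IsComplete (A : C) : Prop :=
  ∀ (Y : C) (F : D.P (Y ⨯ A)), D.IsFunctional F → ∃! f : Y ⟶ A, D.graph f = F

/-- `A` is a `P`-sheaf: it is orthogonal to all internally bijective morphisms. -/
def IsSheaf (A : C) : Prop :=
  ∀ (X Y : C) (d : X ⟶ Y) (q : X ⟶ A), D.InternallyBijective d →
    ∃! h : Y ⟶ A, d ≫ h = q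

/-- `m : X ⟶ A` is a comprehension of `α ∈ P(A)`. -/
structure IsComprehension {X A : C} (m : X ⟶ A) (α : D.P A) : Prop where
  le : (⊤ : D.P X) ≤ D.map m α
  factor : ∀ {Y : C} (f : Y ⟶ A), (⊤ : D.P Y) ≤ D.map f α → ∃! h : Y ⟶ X, h ≫ m = f

/-- Data witnessing that a doctrine has singletons: power objects `pow A` with membership
predicates `mem A` and naming morphisms `name`, together with comprehensions
`compr A : S A ⟶ pow A` of `σ_A = ∃_{{δ_A}}⊤_A` and the induced units `eta A : A ⟶ S A`. -/
structure SingletonsData where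
  pow : C → C
  mem : ∀ A : C, D.P (A ⨯ pow A)
  name : ∀ {A Y : C}, D.P (A ⨯ Y) → (Y ⟶ pow A)
  S : C → C
  compr : ∀ A : C, S A ⟶ pow A
  eta : ∀ A : C, A ⟶ S A

variable {D}

/-- The properties making `SD` a singletons structure on the doctrine `D`: the power-object
universal property, `{δ_A}` is internally injective, `compr A` is a comprehension of
`σ_A = ∃_{{δ_A}}⊤_A` (so `{δ_A}` has an image), `eta A` is the unique morphism with
`⌊σ_A⌋ ∘ η_A = {δ_A}`, and `(id_A×g)*∈_A` is functional iff `g*σ_A = ⊤`. -/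
structure IsSingletons (SD : D.SingletonsData) : Prop where
  name_eq : ∀ {A Y : C} (γ : D.P (A ⨯ Y)),
    γ = D.map (prod.map (𝟙 A) (SD.name γ)) (SD.mem A)
  name_unique : ∀ {A Y : C} (γ : D.P (A ⨯ Y)) (g : Y ⟶ SD.pow A),
    γ = D.map (prod.map (𝟙 A) g) (SD.mem A) → g = SD.name γ
  singleton_inj : ∀ A : C, D.InternallyInjective (SD.name (D.delta A))
  compr_comprehension : ∀ A : C,
    D.IsComprehension (SD.compr A) (D.ex (SD.name (D.delta A)) (⊤ : D.P A))
  eta_compr : ∀ A : C, SD.eta A ≫ SD.compr A = SD.name (D.delta A)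
  functional_iff : ∀ {A Y : C} (g : Y ⟶ SD.pow A),
    D.IsFunctional (D.map (prod.map (𝟙 A) g) (SD.mem A)) ↔
      D.map g (D.ex (SD.name (D.delta A)) (⊤ : D.P A)) = ⊤

variable (D)

/-- The properties making `Map(C,P)` a well-defined category: functional relations are
closed under relational composition, the equality predicates are two-sided identities, and
relational composition is associative. -/
structure MapCatStruct : Prop where
  id_functional : ∀ A : C, D.IsFunctional (D.delta A)
  comp_functional : ∀ {A B E : C} (F : D.P (A ⨯ B)) (G : D.P (B ⨯ E)),
    D.IsFunctional F → D.IsFunctional G → D.IsFunctional (D.relComp F G)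
  id_comp : ∀ {A B : C} (F : D.P (A ⨯ B)), D.IsFunctional F →
    D.relComp (D.delta A) F = F
  comp_id : ∀ {A B : C} (F : D.P (A ⨯ B)), D.IsFunctional F →
    D.relComp F (D.delta B) = F
  assoc : ∀ {A B E W : C} (F : D.P (A ⨯ B)) (G : D.P (B ⨯ E)) (H : D.P (E ⨯ W)),
    D.IsFunctional F → D.IsFunctional G → D.IsFunctional H →
    D.relComp (D.relComp F G) H = D.relComp F (D.relComp G H)

namespace IsEED

variable {D}

theorem map_mono (hD : D.IsEED) {A B : C} (f : A ⟶ B) {φ ψ : D.P B} (h : φ ≤ ψ) :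
    D.map f φ ≤ D.map f ψ := by
  rw [← inf_eq_left] at h ⊢
  rw [← hD.map_inf, h]

theorem le_map_ex (hD : D.IsEED) {A B : C} (f : A ⟶ B) (α : D.P A) :
    α ≤ D.map f (D.ex f α) :=
  (hD.adj f α _).1 le_rfl

/-- A total relation `F` satisfies `δ_Y ≤ F^op∘F`. -/
theorem delta_le_relComp_opp (hD : D.IsEED) {Y A : C} (F : D.P (Y ⨯ A))
    (hF : D.ex (prod.fst : Y ⨯ A ⟶ Y) F = ⊤) : D.delta Y ≤ D.relComp F (D.opp F) := by
  let d : Y ⨯ A ⟶ (Y ⨯ A) ⨯ Y := prod.lift (𝟙 _) prod.fst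
  have hd₁₃ : d ≫ p13 Y A Y = prod.fst ≫ diag Y := by
    ext <;> simp [d, p13, prod.lift_fst, prod.lift_snd, prod.lift_fst_assoc]
  have hd₁₂ : d ≫ p12 Y A Y = 𝟙 _ := by
    ext <;> simp [d, p12, prod.lift_fst_assoc]
  have hd₂₃ : d ≫ p23 Y A Y ≫ prod.lift prod.snd prod.fst = 𝟙 _ := by
    ext <;> simp [d, p23, prod.lift_fst, prod.lift_snd, prod.lift_fst_assoc]
  have hFd : D.map d (D.map (p12 Y A Y) F ⊓ D.map (p23 Y A Y) (D.opp F)) = F := by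
    simp only [opp, hD.map_inf, ← hD.map_comp, hd₁₂, hd₂₃, hD.map_id, inf_idem]
  rw [delta, hD.adj, ← hF, hD.adj, ← hD.map_comp, ← hd₁₃, hD.map_comp]
  exact hFd.ge.trans (hD.map_mono d (hD.le_map_ex _ _))

/-- A single-valued relation `F` satisfies `F∘F^op ≤ δ_A`. -/
theorem relComp_opp_le_delta (hD : D.IsEED) {Y A : C} (F : D.P (Y ⨯ A))
    (hF : D.map (p12 Y A A) F ⊓ D.map (p13 Y A A) F ≤ D.map (p23 Y A A) (D.delta A)) :
    D.relComp (D.opp F) F ≤ D.delta A := by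
  let s : (A ⨯ Y) ⨯ A ⟶ (Y ⨯ A) ⨯ A :=
    prod.lift (prod.lift (prod.fst ≫ prod.snd) (prod.fst ≫ prod.fst)) prod.snd
  have hs₁₂ : s ≫ p12 Y A A = p12 A Y A ≫ prod.lift prod.snd prod.fst := by
    ext <;> simp [s, p12, prod.lift_fst, prod.lift_snd, prod.lift_fst_assoc]
  have hs₁₃ : s ≫ p13 Y A A = p23 A Y A := by
    ext <;> simp [s, p13, p23, prod.lift_fst, prod.lift_snd, prod.lift_fst_assoc]
  have hs₂₃ : s ≫ p23 Y A A = p13 A Y A := by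
    ext <;> simp [s, p13, p23, prod.lift_fst, prod.lift_snd, prod.lift_fst_assoc]
  rw [relComp, hD.adj, opp]
  simpa only [hD.map_inf, ← hD.map_comp, hs₁₂, hs₁₃, hs₂₃] using hD.map_mono s hF

end IsEED

end DoctrineData

/-- In an elementary existential doctrine every functional relation
`F ∈ P(Y×A)` is left adjoint to `F^op = ⟨π₂,π₁⟩*F`: `δ_Y ≤ F^op∘F` and `F∘F^op ≤ δ_A`
(compositions written in diagrammatic order: `F^op∘F = D.relComp F (D.opp F)`). -/
theorem functional_is_left_adjoint (D : DoctrineData.{w} C) (hD : D.IsEED)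
    {Y A : C} (F : D.P (Y ⨯ A)) (hF : D.IsFunctional F) :
    D.delta Y ≤ D.relComp F (D.opp F) ∧ D.relComp (D.opp F) F ≤ D.delta A := by
  exact ⟨hD.delta_le_relComp_opp F hF.2, hD.relComp_opp_le_delta F hF.1⟩
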